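/- Let w be a word of length n over an alphabet Σ, and let u be a nonempty word with a non-trivial border s that is a longest non-trivial border of u (i.e., s ≠ ε, s ≠ u, and every border b of u with b ≠ u satisfies |b| ≤ |s|), so that u = sx = ys for some words x and y. Assume n = 2|u| − |s| and that (u, n) is a representation of the circular word w_o. Then (y, n) is a minimal representation of w_o; that is, |y| ≤ |u'| for every representation (u', n) of w_o. -/

import Mathlib

/-- Words `x` and `y` are conjugates: `x = s ++ t` and `y = t ++ s`. -/
def IsConjugate {α : Type*} (x y : List α) : Prop :=
  ∃ s t : List α, x = s ++ t ∧ y = t ++ s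

/-- The fractional power `u^(p/|u|)`: the word of length `p` whose `(i+1)`-st letter
is the `((i mod |u|)+1)`-st letter of `u` (for nonempty `u`). -/
def fracPow {α : Type*} (u : List α) (p : ℕ) : List α :=
  ((List.replicate (p / u.length + 1) u).flatten).take p

/-- `(u, n)` is a representation of the circular word `w_o`. -/
def IsRepresentation {α : Type*} (w u : List α) (n : ℕ) : Prop :=
  u ≠ [] ∧ u.length ≤ n ∧ n = w.length ∧ IsConjugate (fracPow u n) w

/-- `(u, n)` is a minimal representation of the circular word `w_o`. -/
def IsMinimalRepresentation {α : Type*} (w u : List α) (n : ℕ) : Prop :=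
  IsRepresentation w u n ∧
    ∀ u' : List α, IsRepresentation w u' n → u.length ≤ u'.length

/-- `b` is a border of `w`: a common prefix and suffix. -/
def IsBorder {α : Type*} (b w : List α) : Prop := b <+: w ∧ b <:+ w

/-- `p` is a branching prefix for `w`: two distinct letters can extend `p`
inside conjugates of `w`. -/
def IsBranchingPrefix {α : Type*} (p w : List α) : Prop :=
  ∃ c d : α, c ≠ d ∧
    (∃ v : List α, IsConjugate v w ∧ (p ++ [c]) <+: v) ∧
    (∃ v : List α, IsConjugate v w ∧ (p ++ [d]) <+: v)

/-- The finite Fibonacci words over the two-letter alphabet `Bool`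
(`true` plays the role of `a`, `false` of `b`): `f₁ = b`, `f₂ = a`,
`fₙ = fₙ₋₁ fₙ₋₂`. -/
def fibWord : ℕ → List Bool
  | 0 => []
  | 1 => [false]
  | 2 => [true]
  | (n+3) => fibWord (n+2) ++ fibWord (n+1)

theorem fp_flat {α : Type*} (u : List α) (hu : u ≠ []) (k i : ℕ) (h : i < k * u.length) :
    ((List.replicate k u).flatten)[i]? = u[i % u.length]? := by
  have hpos : 0 < u.length := List.length_pos_iff.mpr hu
  induction k generalizing i with
  | zero => simp at h
  | succ k ih =>
    rw [List.replicate_succ, List.flatten_cons, List.getElem?_append]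
    split_ifs with h1
    · rw [Nat.mod_eq_of_lt h1]
    · rw [ih (i - u.length) (by rw [Nat.succ_mul] at h; omega)]
      rw [← Nat.mod_eq_sub_mod (by omega)]

theorem fp_get {α : Type*} (u : List α) (hu : u ≠ []) (n i : ℕ) (h : i < n) :
    (fracPow u n)[i]? = u[i % u.length]? := by
  have hpos : 0 < u.length := List.length_pos_iff.mpr hu
  unfold fracPow
  rw [List.getElem?_take_of_lt h]
  apply fp_flat u hu
  have := Nat.lt_div_mul_add (a := n) hpos
  rw [Nat.succ_mul]; omega

theorem fp_len {α : Type*} (u : List α) (hu : u ≠ []) (n : ℕ) :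
    (fracPow u n).length = n := by
  have hpos : 0 < u.length := List.length_pos_iff.mpr hu
  unfold fracPow
  have := Nat.lt_div_mul_add (a := n) hpos
  simp only [List.length_take, List.length_flatten, List.map_replicate, List.sum_replicate,
    smul_eq_mul, Nat.succ_mul]
  omega

theorem conj_iff {α : Type*} (x y : List α) : IsConjugate x y ↔ x ~r y := by
  constructor
  · rintro ⟨s, t, rfl, rfl⟩
    exact List.isRotated_append
  · rintro ⟨k, rfl⟩
    refine ⟨x.take (k % x.length), x.drop (k % x.length), by simp, ?_⟩
    rw [List.rotate_eq_drop_append_take_mod]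

theorem ext_fp {α : Type*} (u v : List α) (hu : u ≠ []) (n : ℕ) (hv : v.length = n)
    (h : ∀ i < n, v[i]? = u[i % u.length]?) : fracPow u n = v := by
  apply List.ext_getElem?
  intro i
  by_cases hi : i < n
  · rw [fp_get u hu n i hi, h i hi]
  · rw [List.getElem?_eq_none (by rw [fp_len u hu]; omega),
      List.getElem?_eq_none (by omega)]

theorem per_get {α : Type*} (u s x y : List α) (hsx : u = s ++ x) (hys : u = y ++ s)
    (hy : y ≠ []) (i : ℕ) (hi : i < u.length) : u[i]? = y[i % y.length]? := by
  have hpos : 0 < y.length := List.length_pos_iff.mpr hy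
  have hl : u.length = y.length + s.length := by rw [hys]; simp
  induction i using Nat.strong_induction_on with
  | _ i ih =>
    by_cases h : i < y.length
    · rw [Nat.mod_eq_of_lt h, hys, List.getElem?_append_left h]
    · have h1 : u[i]? = s[i - y.length]? := by
        rw [hys, List.getElem?_append_right (by omega)]
      have h2 : u[i - y.length]? = s[i - y.length]? := by
        rw [hsx, List.getElem?_append_left (by omega)]
      rw [h1, ← h2, ih _ (by omega) (by omega), ← Nat.mod_eq_sub_mod (by omega)]

/-- If s is a longest non-trivial border of u, u = s ++ x = y ++ s,
n = 2|u| - |s|, and (u, n) is a representation of w_o, then (y, n) is a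
minimal representation of w_o. -/
theorem longest_border_gives_minimal_representation {α : Type*}
    (w u s x y : List α) (n : ℕ)
    (hu : u ≠ []) (hsx : u = s ++ x) (hys : u = y ++ s)
    (hse : s ≠ []) (hsu : s ≠ u)
    (hlongest : ∀ b : List α, IsBorder b u → b ≠ u → b.length ≤ s.length)
    (hn : n = 2 * u.length - s.length)
    (hrep : IsRepresentation w u n) :
    IsMinimalRepresentation w y n := by
  have hy : y ≠ [] := by
    rintro rfl
    exact hsu (by simpa using hys.symm)
  have hp : 0 < y.length := List.length_pos_iff.mpr hy
  have hk : 0 < s.length := List.length_pos_iff.mpr hse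
  have hl : u.length = y.length + s.length := by rw [hys]; simp
  have hper := per_get u s x y hsx hys hy
  obtain ⟨-, hun, hnw, hconj⟩ := hrep
  have hU : fracPow u n = u ++ y := by
    apply ext_fp u _ hu n (by simp; omega)
    intro i hi
    by_cases h : i < u.length
    · rw [List.getElem?_append_left h, Nat.mod_eq_of_lt h]
    · rw [List.getElem?_append_right (by omega), Nat.mod_eq_sub_mod (by omega),
        Nat.mod_eq_of_lt (by omega)]
      have h3 : i - u.length < y.length := by omega
      rw [hys, List.getElem?_append_left (by rw [← hys]; omega)]
  have hW : fracPow y n = y ++ u := by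
    apply ext_fp y _ hy n (by simp; omega)
    intro i hi
    by_cases h : i < y.length
    · rw [List.getElem?_append_left h, Nat.mod_eq_of_lt h]
    · rw [List.getElem?_append_right (by omega), hper _ (by omega),
        ← Nat.mod_eq_sub_mod (by omega)]
  have hyw : IsConjugate (fracPow y n) w := by
    rw [conj_iff] at hconj ⊢
    rw [hW]
    rw [hU] at hconj
    exact List.isRotated_append.trans hconj
  refine ⟨⟨hy, by omega, hnw, hyw⟩, ?_⟩
  rintro v ⟨hv, hvn, -, hvw⟩
  by_contra hlt
  have hq : 0 < v.length := List.length_pos_iff.mpr hv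
  have hc : IsConjugate (fracPow y n) (fracPow v n) := by
    rw [conj_iff] at hyw hvw ⊢
    exact hyw.trans hvw.symm
  obtain ⟨A, B, hA, hB⟩ := hc
  have hlen : A.length + B.length = n := by
    rw [← List.length_append, ← hA, fp_len y hy]
  have hWy : ∀ i < n, (A ++ B)[i]? = y[i % y.length]? := fun i hi => by
    rw [← hA, fp_get y hy n i hi]
  obtain ⟨f, hf⟩ : ∃ f : ℕ → Option α, ∀ i, f i = v[i % v.length]? := ⟨_, fun _ => rfl⟩
  have hfq : ∀ i, f (i + v.length) = f i := fun i => by simp [hf]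
  have hVf : ∀ i < n, (B ++ A)[i]? = f i := fun i hi => by
    rw [← hB, fp_get v hv n i hi, hf]
  obtain ⟨g, hg⟩ : ∃ g : ℕ → Option α, ∀ i, g i = y[i % y.length]? := ⟨_, fun _ => rfl⟩
  have hgp : ∀ i, g (i + y.length) = g i := fun i => by simp [hg]
  have hug : ∀ i < u.length, u[i]? = g i := fun i hi => by rw [hper i hi, hg]
  have hgA : ∀ i < A.length, g i = f (B.length + i) := fun i hi => by
    rw [hg, ← hWy i (by omega), ← hVf _ (by omega), List.getElem?_append_left hi,
      List.getElem?_append_right (by omega)]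
    congr 1; omega
  have hgB : ∀ i < B.length, g (A.length + i) = f i := fun i hi => by
    rw [hg, ← hWy _ (by omega), ← hVf _ (by omega), List.getElem?_append_left hi,
      List.getElem?_append_right (by omega)]
    congr 1; omega
  have key : ∃ d, ∀ i < u.length, u[i]? = f (d + i) := by
    by_cases h1 : A.length ≤ y.length
    · refine ⟨y.length - A.length, fun i hi => ?_⟩
      rw [hug i hi, ← hgp, ← hgB _ (by omega)]
      congr 1; omega
    by_cases h2 : u.length ≤ A.length
    · refine ⟨B.length, fun i hi => ?_⟩
      rw [hug i hi, ← hgA _ (by omega)]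
    have hm : ∀ i, f (i + u.length) = f i := by
      intro i
      induction i using Nat.strong_induction_on with
      | _ i ih =>
        by_cases h : i < y.length
        · have e1 := hgB i (by omega)
          have e2 := hgA (A.length + i - y.length) (by omega)
          have e3 := hgp (A.length + i - y.length)
          rw [show A.length + i - y.length + y.length = A.length + i by omega] at e3
          rw [← e1, e3, e2]
          congr 1; omega
        · have e := ih (i - v.length) (by omega)
          have e1 := hfq (i - v.length)
          have e2 := hfq (i - v.length + u.length)
          rw [show i - v.length + v.length = i by omega] at e1
          rw [show i - v.length + u.length + v.length = i + u.length by omega] at e2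
          rw [e1, e2, e]
    refine ⟨B.length, fun i hi => ?_⟩
    rw [hug i hi]
    by_cases h : i < A.length
    · exact hgA i h
    · have e1 := hgB (y.length + i - A.length) (by omega)
      rw [show A.length + (y.length + i - A.length) = i + y.length by omega, hgp] at e1
      rw [e1, ← hm]
      congr 1; omega
  obtain ⟨d, hd⟩ := key
  have heq : u.take (u.length - v.length) = u.drop v.length := by
    apply List.ext_getElem?
    intro i
    by_cases hi : i < u.length - v.length
    · rw [List.getElem?_take_of_lt hi, List.getElem?_drop, hd _ (by omega), hd _ (by omega),
        ← hfq]
      congr 1; omega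
    · rw [List.getElem?_eq_none (by simp; omega), List.getElem?_eq_none (by simp; omega)]
  have hb := hlongest (u.take (u.length - v.length))
    ⟨List.take_prefix _ _, heq ▸ List.drop_suffix _ _⟩ (by
      intro h
      have := congrArg List.length h
      simp at this
      omega)
  simp at hb
  omega
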